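/- For any pair of random variables (X,Y) on finite sets with joint distribution P_{XY}, C_X(Y) = 0 if and only if X and Y are independent. -/

import Mathlib

open scoped BigOperators Classical

/-- Shannon entropy (base 2) of a distribution on a finite alphabet,
with the convention `0 * logb 2 0 = 0`. -/
noncomputable def H {α : Type*} [Fintype α] (p : α → ℝ) : ℝ :=
  ∑ a, -(p a * Real.logb 2 (p a))

/-- `p` is a probability mass function on a finite alphabet. -/
def IsPMF {α : Type*} [Fintype α] (p : α → ℝ) : Prop :=
  (∀ a, 0 ≤ p a) ∧ ∑ a, p a = 1

/-- First marginal of a joint distribution. -/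
noncomputable def fstM {α β : Type*} [Fintype α] [Fintype β] (p : α × β → ℝ) : α → ℝ :=
  fun a => ∑ b, p (a, b)

/-- Second marginal of a joint distribution. -/
noncomputable def sndM {α β : Type*} [Fintype α] [Fintype β] (p : α × β → ℝ) : β → ℝ :=
  fun b => ∑ a, p (a, b)

/-- Mutual information (base 2) of a joint distribution. -/
noncomputable def MI {α β : Type*} [Fintype α] [Fintype β] (p : α × β → ℝ) : ℝ :=
  H (fstM p) + H (sndM p) - H p

/-- Marginal on the first two coordinates of a triple. -/
noncomputable def m12 {α β γ : Type*} [Fintype α] [Fintype β] [Fintype γ]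
    (q : α × β × γ → ℝ) : α × β → ℝ := fun ab => ∑ c, q (ab.1, ab.2, c)

/-- Marginal on the first and third coordinates of a triple. -/
noncomputable def m13 {α β γ : Type*} [Fintype α] [Fintype β] [Fintype γ]
    (q : α × β × γ → ℝ) : α × γ → ℝ := fun ac => ∑ b, q (ac.1, b, ac.2)

/-- Marginal on the last two coordinates of a triple. -/
noncomputable def m23 {α β γ : Type*} [Fintype α] [Fintype β] [Fintype γ]
    (q : α × β × γ → ℝ) : β × γ → ℝ := fun bc => ∑ a, q (a, bc.1, bc.2)

/-- `A → B → C` is a Markov chain for a joint distribution `q` on `α × β × γ`: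
`A` and `C` are conditionally independent given the middle variable `B`. -/
def Markov {α β γ : Type*} [Fintype α] [Fintype β] [Fintype γ]
    (q : α × β × γ → ℝ) : Prop :=
  ∀ a b c, q (a, b, c) * (∑ a', ∑ c', q (a', b, c')) =
    (∑ c', q (a, b, c')) * (∑ a', q (a', b, c))

/-- The set of achievable utilities `I(Y;Z)` over finite-valued `Z` with
`X → Y → Z` a Markov chain and privacy leakage `I(X;Z) ≤ ε`. -/
def PrivSet {α β : Type*} [Fintype α] [Fintype β] (ε : ℝ) (p : α × β → ℝ) : Set ℝ :=
  { r | ∃ (γ : Type) (_ : Fintype γ) (q : α × β × γ → ℝ),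
      IsPMF q ∧ m12 q = p ∧ Markov q ∧ MI (m13 q) ≤ ε ∧ r = MI (m23 q) }

/-- The rate-privacy function `g_ε(X;Y)`. -/
noncomputable def g {α β : Type*} [Fintype α] [Fintype β] (ε : ℝ) (p : α × β → ℝ) : ℝ :=
  sSup (PrivSet ε p)

/-- The conditional distribution `P_{X|Y}(·|y)` (the zero map if `P_Y(y) = 0`). -/
noncomputable def condX {α β : Type*} [Fintype α] [Fintype β] (p : α × β → ℝ) (y : β) :
    α → ℝ := fun x => p (x, y) / sndM p y

/-- `X` is weakly independent of `Y`: the family of conditional distributions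
`P_{X|Y}(·|y)`, for `y` in the support of `P_Y`, is linearly dependent. -/
def WeaklyIndep {α β : Type*} [Fintype α] [Fintype β] (p : α × β → ℝ) : Prop :=
  ¬ LinearIndependent ℝ (fun y : {y : β // 0 < sndM p y} => condX p y.1)

/-- `C_X(Y)`: the minimum of `H(W)` over finite-valued `W` with `X → W → Y` a
Markov chain and `H(W|Y) = 0`, i.e. `W = f(Y)` for a deterministic `f`. -/
noncomputable def Cmin {α β : Type*} [Fintype α] [Fintype β] (p : α × β → ℝ) : ℝ :=
  sInf { r | ∃ (γ : Type) (_ : Fintype γ) (f : β → γ),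
      Markov (fun xwy : α × γ × β => if f xwy.2.2 = xwy.2.1 then p (xwy.1, xwy.2.2) else 0) ∧
      r = H (fun w : γ => ∑ y, if f y = w then sndM p y else 0) }

/-- Common entropy `G(X;Y)`: the minimum of `H(W)` over finite-valued `W`
with `X → W → Y` a Markov chain. -/
noncomputable def Gmin {α β : Type*} [Fintype α] [Fintype β] (p : α × β → ℝ) : ℝ :=
  sInf { r | ∃ (γ : Type) (_ : Fintype γ) (q : α × γ × β → ℝ),
      IsPMF q ∧ m13 q = p ∧ Markov q ∧ r = H (fstM (m23 q)) }

/-- Entropy of the push-forward of the distribution `pY` under the map `f`. -/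
noncomputable def Hpush {β S : Type*} [Fintype β] (pY : β → ℝ) (f : β → S) : ℝ :=
  letI := Classical.decEq S
  ∑ t ∈ Finset.image f Finset.univ,
    -((∑ y ∈ Finset.univ.filter fun y => f y = t, pY y) *
      Real.logb 2 (∑ y ∈ Finset.univ.filter fun y => f y = t, pY y))

/-- The mass of the fibre of `f` through `y`. -/
noncomputable def fibreMass {β γ : Type*} [Fintype β] (m : β → ℝ) (f : β → γ) (y : β) : ℝ :=
  ∑ y', if f y' = f y then m y' else 0

theorem fibreMass_nonneg {β γ : Type*} [Fintype β] {m : β → ℝ} (hm : ∀ y, 0 ≤ m y)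
    (f : β → γ) (y : β) : 0 ≤ fibreMass m f y :=
  Finset.sum_nonneg fun y' _ => by
    split_ifs
    exacts [hm y', le_rfl]

theorem fibreMass_le_sum {β γ : Type*} [Fintype β] {m : β → ℝ} (hm : ∀ y, 0 ≤ m y)
    (f : β → γ) (y : β) : fibreMass m f y ≤ ∑ y', m y' :=
  Finset.sum_le_sum fun y' _ => by
    split_ifs
    exacts [le_rfl, hm y']

theorem le_fibreMass {β γ : Type*} [Fintype β] {m : β → ℝ} (hm : ∀ y, 0 ≤ m y)
    (f : β → γ) (y : β) : m y ≤ fibreMass m f y := by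
  have h := Finset.single_le_sum (f := fun y' => if f y' = f y then m y' else 0)
    (fun y' _ => by
      split_ifs
      exacts [hm y', le_rfl]) (Finset.mem_univ y)
  simpa [fibreMass] using h

/-- The entropy of a push-forward as a sum over the source alphabet. -/
theorem H_push_eq {β γ : Type*} [Fintype β] [Fintype γ] (m : β → ℝ) (f : β → γ) :
    H (fun w : γ => ∑ y, if f y = w then m y else 0) =
      ∑ y, -(m y * Real.logb 2 (fibreMass m f y)) := by
  simp only [H, Finset.sum_mul, Finset.sum_neg_distrib]
  rw [Finset.sum_comm]
  congr 1
  refine Finset.sum_congr rfl fun y _ => ?_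
  simp [fibreMass, ite_mul]

theorem fibre_entropy_term_nonneg {β γ : Type*} [Fintype β] {m : β → ℝ} (hm : IsPMF m)
    (f : β → γ) (y : β) : 0 ≤ -(m y * Real.logb 2 (fibreMass m f y)) := by
  have h := Real.logb_nonpos one_lt_two (fibreMass_nonneg hm.1 f y)
    ((fibreMass_le_sum hm.1 f y).trans_eq hm.2)
  have := mul_nonpos_of_nonneg_of_nonpos (hm.1 y) h
  linarith

theorem H_push_nonneg {β γ : Type*} [Fintype β] [Fintype γ] {m : β → ℝ} (hm : IsPMF m)
    (f : β → γ) : 0 ≤ H (fun w : γ => ∑ y, if f y = w then m y else 0) := by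
  rw [H_push_eq]
  exact Finset.sum_nonneg fun y _ => fibre_entropy_term_nonneg hm f y

/-- If the push-forward has zero entropy, every fibre of positive mass carries all the mass. -/
theorem fibreMass_eq_one {β γ : Type*} [Fintype β] [Fintype γ] {m : β → ℝ} (hm : IsPMF m)
    {f : β → γ} (h : H (fun w : γ => ∑ y, if f y = w then m y else 0) = 0) {y : β}
    (hy : m y ≠ 0) : fibreMass m f y = 1 := by
  rw [H_push_eq, Finset.sum_eq_zero_iff_of_nonneg
    fun y _ => fibre_entropy_term_nonneg hm f y] at h
  have h0 := h y (Finset.mem_univ y)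
  have hpos : 0 < fibreMass m f y :=
    ((hm.1 y).lt_of_ne' hy).trans_le (le_fibreMass hm.1 f y)
  rw [neg_eq_zero, mul_eq_zero, or_iff_right hy] at h0
  exact Real.eq_one_of_pos_of_logb_eq_zero one_lt_two hpos h0

theorem eq_zero_of_fibreMass_eq_one {β γ : Type*} [Fintype β] {m : β → ℝ} (hm : IsPMF m)
    {f : β → γ} {y y' : β} (h : fibreMass m f y = 1) (hy' : f y' ≠ f y) : m y' = 0 := by
  have h1 := (Finset.sum_eq_sum_iff_of_le (s := Finset.univ)
    (f := fun y' => if f y' = f y then m y' else 0) (g := m) fun y' _ => by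
      split_ifs
      exacts [le_rfl, hm.1 y']).1 (h.trans hm.2.symm) y' (Finset.mem_univ y')
  simpa [hy'] using h1.symm

theorem IsPMF.sndM {α β : Type*} [Fintype α] [Fintype β] {p : α × β → ℝ} (hp : IsPMF p) :
    IsPMF (sndM p) := by
  refine ⟨fun y => Finset.sum_nonneg fun x _ => hp.1 _, ?_⟩
  rw [← hp.2, Fintype.sum_prod_type_right]
  rfl

theorem eq_zero_of_sndM_eq_zero {α β : Type*} [Fintype α] [Fintype β] {p : α × β → ℝ}
    (hp : ∀ a, 0 ≤ p a) {y : β} (hy : sndM p y = 0) (x : α) : p (x, y) = 0 :=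
  (Finset.sum_eq_zero_iff_of_nonneg fun x _ => hp (x, y)).1 hy x (Finset.mem_univ x)

/-- `X → f(Y) → Y` is a Markov chain iff `P(x, y) P(f(Y) = f(y)) = P(x, f(Y) = f(y)) P(y)`. -/
theorem markov_map_iff {α β γ : Type*} [Fintype α] [Fintype β] [Fintype γ] (p : α × β → ℝ)
    (f : β → γ) :
    Markov (fun xwy : α × γ × β => if f xwy.2.2 = xwy.2.1 then p (xwy.1, xwy.2.2) else 0) ↔
      ∀ x y, p (x, y) * fibreMass (sndM p) f y =
        fibreMass (fun y' => p (x, y')) f y * sndM p y := by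
  have key (w : γ) : (∑ x, ∑ y, if f y = w then p (x, y) else 0) =
      ∑ y, if f y = w then sndM p y else 0 := by
    rw [Finset.sum_comm]
    refine Finset.sum_congr rfl fun y _ => ?_
    split_ifs <;> simp [sndM]
  simp only [Markov, key]
  constructor
  · intro h x y
    simpa [fibreMass, sndM] using h x (f y) y
  · intro h x w y
    by_cases hw : f y = w
    · subst hw
      simpa [fibreMass, sndM] using h x y
    · simp [hw]

/-- The entropies of the admissible `W`, whose infimum is `C_X(Y)`. -/
def CminSet {α β : Type*} [Fintype α] [Fintype β] (p : α × β → ℝ) : Set ℝ :=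
  { r | ∃ (γ : Type) (_ : Fintype γ) (f : β → γ),
      Markov (fun xwy : α × γ × β => if f xwy.2.2 = xwy.2.1 then p (xwy.1, xwy.2.2) else 0) ∧
      r = H (fun w : γ => ∑ y, if f y = w then sndM p y else 0) }

theorem CminSet_finite {α β : Type*} [Fintype α] [Fintype β] (p : α × β → ℝ) :
    (CminSet p).Finite := by
  refine (Set.finite_range fun K : β → β → Prop =>
    ∑ y, -(sndM p y * Real.logb 2 (∑ y', if K y' y then sndM p y' else 0))).subset ?_
  rintro r ⟨γ, _, f, -, rfl⟩
  exact ⟨fun y' y => f y' = f y, (H_push_eq _ f).symm⟩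

theorem CminSet_nonempty {α β : Type*} [Fintype α] [Fintype β] (p : α × β → ℝ) :
    (CminSet p).Nonempty := by
  refine ⟨_, Fin (Fintype.card β), inferInstance, Fintype.equivFin β, ?_, rfl⟩
  rw [markov_map_iff]
  intro x y
  simp [fibreMass]

theorem Cmin_mem {α β : Type*} [Fintype α] [Fintype β] (p : α × β → ℝ) :
    Cmin p ∈ CminSet p :=
  (CminSet_nonempty p).csInf_mem (CminSet_finite p)

theorem Cmin_nonneg {α β : Type*} [Fintype α] [Fintype β] {p : α × β → ℝ} (hp : IsPMF p) :
    0 ≤ Cmin p := by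
  obtain ⟨γ, _, f, -, h⟩ := Cmin_mem p
  exact h ▸ H_push_nonneg hp.sndM f

/-- `C_X(Y) = 0` iff `X` and `Y` are independent. -/
theorem stmt8 {𝒳 𝒴 : Type*} [Fintype 𝒳] [Fintype 𝒴] (p : 𝒳 × 𝒴 → ℝ)
    (hp : IsPMF p) :
    Cmin p = 0 ↔ ∀ x y, p (x, y) = fstM p x * sndM p y := by
  constructor
  · intro h0 x y
    obtain ⟨γ, _, f, hM, h⟩ := Cmin_mem p
    rw [markov_map_iff] at hM
    by_cases hy : sndM p y = 0
    · rw [hy, mul_zero, eq_zero_of_sndM_eq_zero hp.1 hy x]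
    · have h1 := fibreMass_eq_one hp.sndM (h.symm.trans h0) hy
      have hfst : fibreMass (fun y' => p (x, y')) f y = fstM p x := by
        refine Finset.sum_congr rfl fun y' _ => ?_
        split_ifs with hf
        · rfl
        · exact (eq_zero_of_sndM_eq_zero hp.1
            (eq_zero_of_fibreMass_eq_one hp.sndM h1 hf) x).symm
      rw [← hfst, ← hM x y, h1, mul_one]
  · intro h
    refine le_antisymm (csInf_le (CminSet_finite p).bddBelow
      ⟨Unit, inferInstance, fun _ => (), ?_, ?_⟩) (Cmin_nonneg hp)
    · refine (markov_map_iff p fun _ => ()).2 fun x y => ?_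
      simpa [fibreMass, hp.sndM.2, fstM] using h x y
    · simp [H, hp.sndM.2]
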